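/- arXiv:1507.01995 — 3 statements merged into one kernel-verified Lean document; each statement's English description precedes it below -/
import Mathlib

section
/- Let n ≥ 1, 0 < ε ≤ 1/2, let μ ∈ ℝⁿ, and let L be any n × n real matrix. The set {(x, b, k, z) ∈ ℝⁿ × ℝ × ℝ × ℝ : μ_n({ζ ∈ ℝⁿ : (xᵀ(Lζ + μ) + b)² + z² ≤ k}) ≥ 1 − ε} is convex. (This is the chance constraint P((xᵀξ + b)² + z² ≤ k) ≥ 1−ε, where ξ = Lζ + μ is jointly Gaussian and the second quadratic term z² is deterministic.) -/
open MeasureTheory ProbabilityTheory Set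

/-- The law of a vector of `n` i.i.d. standard Gaussian random variables. -/
noncomputable def stdGaussianPi (n : ℕ) : Measure (Fin n → ℝ) :=
  Measure.pi fun _ => gaussianReal 0 1

/-- The standard normal distribution function, normalised to vanish at the origin. -/
noncomputable def centeredNormalCDF (u : ℝ) : ℝ := ∫ t in (0)..u, gaussianPDFReal 0 1 t

lemma continuous_gaussianPDFReal_standard : Continuous (gaussianPDFReal 0 1) := by
  unfold gaussianPDFReal
  fun_prop

lemma hasDerivAt_centeredNormalCDF (u : ℝ) :
    HasDerivAt centeredNormalCDF (gaussianPDFReal 0 1 u) u :=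
  continuous_gaussianPDFReal_standard.integral_hasStrictDerivAt 0 u |>.hasDerivAt

lemma strictMono_centeredNormalCDF : StrictMono centeredNormalCDF :=
  strictMono_of_deriv_pos fun u ↦ by
    rw [(hasDerivAt_centeredNormalCDF u).deriv]
    exact gaussianPDFReal_pos 0 1 u one_ne_zero

@[simp]
lemma centeredNormalCDF_zero : centeredNormalCDF 0 = 0 := by
  simp [centeredNormalCDF]

lemma concaveOn_centeredNormalCDF : ConcaveOn ℝ (Ici 0) centeredNormalCDF := by
  have hd : deriv centeredNormalCDF = gaussianPDFReal 0 1 :=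
    funext fun u ↦ (hasDerivAt_centeredNormalCDF u).deriv
  refine AntitoneOn.concaveOn_of_deriv (convex_Ici 0)
    (fun u _ ↦ (hasDerivAt_centeredNormalCDF u).continuousAt.continuousWithinAt)
    (fun u _ ↦ (hasDerivAt_centeredNormalCDF u).differentiableAt.differentiableWithinAt) ?_
  rw [hd, interior_Ici]
  intro x hx y _ hxy
  have hx : 0 < x := hx
  simp only [gaussianPDFReal, sub_zero]
  gcongr

lemma gaussianReal_real_Icc {u v : ℝ} (h : -v ≤ u) :
    (gaussianReal 0 1).real (Icc (-v) u) = centeredNormalCDF u + centeredNormalCDF v := by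
  have hi (a b : ℝ) : IntervalIntegrable (gaussianPDFReal 0 1) volume a b :=
    continuous_gaussianPDFReal_standard.intervalIntegrable a b
  have hv : ∫ t in (-v)..0, gaussianPDFReal 0 1 t = centeredNormalCDF v := by
    have := intervalIntegral.integral_comp_neg (a := 0) (b := v) (gaussianPDFReal 0 1)
    rw [neg_zero] at this
    rw [← this, centeredNormalCDF]
    simp [gaussianPDFReal]
  rw [Measure.real, gaussianReal_apply_eq_integral _ one_ne_zero, ENNReal.toReal_ofReal
    (integral_nonneg fun _ ↦ gaussianPDFReal_nonneg _ _ _), integral_Icc_eq_integral_Ioc,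
    ← intervalIntegral.integral_of_le h,
    ← intervalIntegral.integral_add_adjacent_intervals (hi (-v) 0) (hi 0 u), hv, add_comm]
  rfl

lemma centeredNormalCDF_le_half (u : ℝ) : centeredNormalCDF u ≤ 1 / 2 := by
  rcases le_total 0 u with hu | hu
  · have h := gaussianReal_real_Icc (u := u) (v := u) (by linarith)
    have h1 : (gaussianReal 0 1).real (Icc (-u) u) ≤ 1 := measureReal_le_one
    linarith
  · have := strictMono_centeredNormalCDF.monotone hu
    rw [centeredNormalCDF_zero] at this
    linarith

lemma nonneg_of_half_le_centeredNormalCDF_add {u v : ℝ}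
    (h : 1 / 2 ≤ centeredNormalCDF u + centeredNormalCDF v) : 0 ≤ u := by
  by_contra! hu
  have := strictMono_centeredNormalCDF hu
  rw [centeredNormalCDF_zero] at this
  linarith [centeredNormalCDF_le_half v]

lemma setOf_abs_mul_add_le {s : ℝ} (hs : 0 < s) (m r : ℝ) :
    {g : ℝ | |s * g + m| ≤ r} = Icc (-((r + m) / s)) ((r - m) / s) := by
  ext g
  rw [mem_ofPred_eq, mem_Icc, abs_le, ← neg_div, div_le_iff₀ hs, le_div_iff₀ hs]
  constructor <;> rintro ⟨_, _⟩ <;> constructor <;> linarith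

lemma abs_le_of_half_le_gaussianReal {s m r c : ℝ} (hs : 0 ≤ s) (hc : 1 / 2 ≤ c)
    (h : c ≤ (gaussianReal 0 1).real {g | |s * g + m| ≤ r}) :
    |m| ≤ r ∧ (0 < s → c ≤ centeredNormalCDF ((r - m) / s) + centeredNormalCDF ((r + m) / s)) := by
  rcases hs.eq_or_lt with rfl | hs
  · refine ⟨?_, fun h0 ↦ absurd h0 (lt_irrefl 0)⟩
    by_contra hm
    simp only [zero_mul, zero_add, hm, ofPred_false, measureReal_empty] at h
    linarith
  · rw [setOf_abs_mul_add_le hs] at h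
    have hle : -((r + m) / s) ≤ (r - m) / s := by
      by_contra! hlt
      rw [Icc_eq_empty hlt.not_ge, measureReal_empty] at h
      linarith
    rw [gaussianReal_real_Icc hle] at h
    have hu := nonneg_of_half_le_centeredNormalCDF_add (hc.trans h)
    have hv := nonneg_of_half_le_centeredNormalCDF_add (hc.trans (h.trans_eq (add_comm _ _)))
    rw [le_div_iff₀ hs, zero_mul] at hu hv
    exact ⟨abs_le.2 ⟨by linarith, by linarith⟩, fun _ ↦ h⟩

lemma centeredNormalCDF_perspective {A B u₁ u₂ : ℝ} (hA : 0 ≤ A) (hB : 0 ≤ B) (hS : 0 < A + B)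
    (hu₁ : 0 ≤ u₁) (hu₂ : 0 ≤ u₂) :
    A / (A + B) * centeredNormalCDF u₁ + B / (A + B) * centeredNormalCDF u₂ ≤
      centeredNormalCDF ((A * u₁ + B * u₂) / (A + B)) := by
  have := concaveOn_centeredNormalCDF.2 (mem_Ici.2 hu₁) (mem_Ici.2 hu₂)
    (div_nonneg hA hS.le) (div_nonneg hB hS.le) (by field_simp)
  simp only [smul_eq_mul] at this
  rwa [div_mul_eq_mul_div _ _ u₁, div_mul_eq_mul_div _ _ u₂, ← add_div] at this

/-- Joint convexity in `(m, s, r)` of the constraint `P(|s g + m| ≤ r) ≥ c`, which is moreover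
monotone in the scale `s`. -/
lemma le_gaussianReal_abs_mul_add_le {c a b s s₁ s₂ m₁ m₂ r₁ r₂ : ℝ} (hc : 1 / 2 ≤ c) (hc1 : c ≤ 1)
    (ha : 0 ≤ a) (hb : 0 ≤ b) (hs₁ : 0 ≤ s₁) (hs₂ : 0 ≤ s₂) (hs : 0 ≤ s)
    (hle : s ≤ a * s₁ + b * s₂)
    (h₁ : c ≤ (gaussianReal 0 1).real {g | |s₁ * g + m₁| ≤ r₁})
    (h₂ : c ≤ (gaussianReal 0 1).real {g | |s₂ * g + m₂| ≤ r₂}) :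
    c ≤ (gaussianReal 0 1).real {g | |s * g + (a * m₁ + b * m₂)| ≤ a * r₁ + b * r₂} := by
  obtain ⟨hm₁, h₁⟩ := abs_le_of_half_le_gaussianReal hs₁ hc h₁
  obtain ⟨hm₂, h₂⟩ := abs_le_of_half_le_gaussianReal hs₂ hc h₂
  rw [abs_le] at hm₁ hm₂
  have hmono := strictMono_centeredNormalCDF.monotone
  have hU₁ : 0 ≤ r₁ - m₁ := by linarith
  have hV₁ : 0 ≤ r₁ + m₁ := by linarith
  have hU₂ : 0 ≤ r₂ - m₂ := by linarith
  have hV₂ : 0 ≤ r₂ + m₂ := by linarith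
  have hU : 0 ≤ a * r₁ + b * r₂ - (a * m₁ + b * m₂) := by
    nlinarith [mul_nonneg ha hU₁, mul_nonneg hb hU₂]
  have hV : 0 ≤ a * r₁ + b * r₂ + (a * m₁ + b * m₂) := by
    nlinarith [mul_nonneg ha hV₁, mul_nonneg hb hV₂]
  rcases hs.eq_or_lt with rfl | hs
  · have : |a * m₁ + b * m₂| ≤ a * r₁ + b * r₂ := abs_le.2 ⟨by linarith, by linarith⟩
    simpa [this] using hc1
  rw [setOf_abs_mul_add_le hs, gaussianReal_real_Icc
    ((neg_nonpos.2 (div_nonneg hV hs.le)).trans (div_nonneg hU hs.le))]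
  have hS : 0 < a * s₁ + b * s₂ := hs.trans_le hle
  suffices h : c ≤
      centeredNormalCDF ((a * r₁ + b * r₂ - (a * m₁ + b * m₂)) / (a * s₁ + b * s₂)) +
      centeredNormalCDF ((a * r₁ + b * r₂ + (a * m₁ + b * m₂)) / (a * s₁ + b * s₂)) from
    h.trans (add_le_add (hmono (div_le_div_of_nonneg_left hU hs hle))
      (hmono (div_le_div_of_nonneg_left hV hs hle)))
  have hA : 0 ≤ a * s₁ := mul_nonneg ha hs₁
  have hB : 0 ≤ b * s₂ := mul_nonneg hb hs₂
  have degenerate {α σ U U' : ℝ} (hσ : 0 < α * σ) (hU' : α * U ≤ U') :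
      centeredNormalCDF (U / σ) ≤ centeredNormalCDF (U' / (α * σ)) := by
    refine hmono ?_
    rw [← mul_div_mul_left U σ (left_ne_zero_of_mul hσ.ne')]
    gcongr
  rcases hA.eq_or_lt with hA0 | hA0
  · rw [← hA0, zero_add] at hS ⊢
    refine (h₂ (pos_of_mul_pos_right hS hb)).trans (add_le_add ?_ ?_)
    · exact degenerate hS (by nlinarith [mul_nonneg ha hU₁])
    · exact degenerate hS (by nlinarith [mul_nonneg ha hV₁])
  rcases hB.eq_or_lt with hB0 | hB0
  · rw [← hB0, add_zero] at hS ⊢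
    refine (h₁ (pos_of_mul_pos_right hS ha)).trans (add_le_add ?_ ?_)
    · exact degenerate hS (by nlinarith [mul_nonneg hb hU₂])
    · exact degenerate hS (by nlinarith [mul_nonneg hb hV₂])
  have hs₁ : 0 < s₁ := pos_of_mul_pos_right hA0 ha
  have hs₂ : 0 < s₂ := pos_of_mul_pos_right hB0 hb
  have key₁ := centeredNormalCDF_perspective hA hB hS
    (div_nonneg hU₁ hs₁.le) (div_nonneg hU₂ hs₂.le)
  have key₂ := centeredNormalCDF_perspective hA hB hS
    (div_nonneg hV₁ hs₁.le) (div_nonneg hV₂ hs₂.le)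
  have cancel {α σ U : ℝ} (hσ : 0 < σ) : α * σ * (U / σ) = α * U := by field_simp
  rw [cancel hs₁, cancel hs₂] at key₁ key₂
  have hw : a * s₁ / (a * s₁ + b * s₂) + b * s₂ / (a * s₁ + b * s₂) = 1 := by field_simp
  have e₁ := mul_le_mul_of_nonneg_left (h₁ hs₁) (div_nonneg hA hS.le)
  have e₂ := mul_le_mul_of_nonneg_left (h₂ hs₂) (div_nonneg hB hS.le)
  calc c = a * s₁ / (a * s₁ + b * s₂) * c + b * s₂ / (a * s₁ + b * s₂) * c := by
        rw [← add_mul, hw, one_mul]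
    _ ≤ centeredNormalCDF ((a * (r₁ - m₁) + b * (r₂ - m₂)) / (a * s₁ + b * s₂)) +
        centeredNormalCDF ((a * (r₁ + m₁) + b * (r₂ + m₂)) / (a * s₁ + b * s₂)) := by linarith
    _ = _ := by congr 3 <;> ring

lemma map_sum_mul_stdGaussianPi {n : ℕ} (w : Fin n → ℝ) :
    (stdGaussianPi n).map (fun ζ ↦ ∑ i, w i * ζ i) =
      (gaussianReal 0 1).map (fun g ↦ ‖WithLp.toLp 2 w‖ * g) := by
  have hcomp : (fun ζ : Fin n → ℝ ↦ ∑ i, w i * ζ i) =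
      innerSL ℝ (WithLp.toLp 2 w) ∘ WithLp.toLp 2 := by
    ext ζ
    simp [PiLp.inner_apply, mul_comm]
  rw [hcomp, ← Measure.map_map (by fun_prop) (by fun_prop), stdGaussianPi, map_pi_eq_stdGaussian,
    IsGaussian.map_eq_gaussianReal, integral_strongDual_stdGaussian, variance_dual_stdGaussian,
    gaussianReal_map_const_mul, innerSL_apply_norm]
  congr 1
  · simp
  · ext
    simp

lemma stdGaussianPi_quadratic_constraint {n : ℕ} (μ x : Fin n → ℝ) (L : Matrix (Fin n) (Fin n) ℝ)
    (b k z : ℝ) :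
    stdGaussianPi n {ζ | (∑ i, x i * (L.mulVec ζ + μ) i + b) ^ 2 + z ^ 2 ≤ k} =
      gaussianReal 0 1
        {g | (‖WithLp.toLp 2 (Matrix.vecMul x L)‖ * g + (x ⬝ᵥ μ + b)) ^ 2 + z ^ 2 ≤ k} := by
  have hm : MeasurableSet {y : ℝ | (y + (x ⬝ᵥ μ + b)) ^ 2 + z ^ 2 ≤ k} :=
    measurableSet_le (by fun_prop) (by fun_prop)
  have h := congrArg (fun ν ↦ ν {y : ℝ | (y + (x ⬝ᵥ μ + b)) ^ 2 + z ^ 2 ≤ k})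
    (map_sum_mul_stdGaussianPi (Matrix.vecMul x L))
  simp only [Measure.map_apply (show Measurable fun ζ : Fin n → ℝ ↦
      ∑ i, Matrix.vecMul x L i * ζ i by fun_prop) hm,
    Measure.map_apply (measurable_const_mul _) hm] at h
  have hx (ζ : Fin n → ℝ) :
      ∑ i, x i * (L.mulVec ζ + μ) i = ∑ i, Matrix.vecMul x L i * ζ i + x ⬝ᵥ μ := by
    change x ⬝ᵥ (L.mulVec ζ + μ) = Matrix.vecMul x L ⬝ᵥ ζ + x ⬝ᵥ μ
    rw [dotProduct_add, Matrix.dotProduct_mulVec]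
  simp_rw [hx, add_assoc]
  exact h

lemma sq_add_sq_le_iff_abs_le {y z k : ℝ} (hk : z ^ 2 ≤ k) :
    y ^ 2 + z ^ 2 ≤ k ↔ |y| ≤ √(k - z ^ 2) := by
  rw [Real.le_sqrt (abs_nonneg y) (sub_nonneg.2 hk), sq_abs, le_sub_iff_add_le]

lemma le_gaussianReal_quadratic_constraint {s m z k c : ℝ} (hc : 0 < c)
    (h : c ≤ (gaussianReal 0 1).real {g | (s * g + m) ^ 2 + z ^ 2 ≤ k}) :
    z ^ 2 ≤ k ∧ c ≤ (gaussianReal 0 1).real {g | |s * g + m| ≤ √(k - z ^ 2)} := by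
  have hk : z ^ 2 ≤ k := by
    by_contra! hk
    have : {g : ℝ | (s * g + m) ^ 2 + z ^ 2 ≤ k} = ∅ :=
      eq_empty_of_forall_notMem fun g (hg : _ ≤ k) ↦ by nlinarith [sq_nonneg (s * g + m)]
    rw [this, measureReal_empty] at h
    linarith
  refine ⟨hk, ?_⟩
  simpa only [sq_add_sq_le_iff_abs_le hk] using h

/-- The chance constraint set `{(x,b,k,z) : P((xᵀ(Lζ+μ) + b)² + z² ≤ k) ≥ 1 − ε}` is
convex, where the second quadratic term `z²` is deterministic. -/
theorem stmt8 (n : ℕ) (hn : 1 ≤ n) (ε : ℝ) (hε0 : 0 < ε) (hε : ε ≤ 1 / 2)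
    (μ : Fin n → ℝ) (L : Matrix (Fin n) (Fin n) ℝ) :
    Convex ℝ {p : (Fin n → ℝ) × ℝ × ℝ × ℝ |
      ((stdGaussianPi n) {ζ : Fin n → ℝ |
        (∑ i, p.1 i * (L.mulVec ζ + μ) i + p.2.1) ^ 2 + p.2.2.2 ^ 2 ≤ p.2.2.1}).toReal
        ≥ 1 - ε} := by
  rintro ⟨x₁, b₁, k₁, z₁⟩ h₁ ⟨x₂, b₂, k₂, z₂⟩ h₂ α β hα hβ hαβ
  simp only [mem_ofPred_eq, Prod.smul_mk, Prod.mk_add_mk, smul_eq_mul, ge_iff_le,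
    stdGaussianPi_quadratic_constraint] at h₁ h₂ ⊢
  obtain ⟨hk₁, h₁⟩ := le_gaussianReal_quadratic_constraint (by linarith) h₁
  obtain ⟨hk₂, h₂⟩ := le_gaussianReal_quadratic_constraint (by linarith) h₂
  have hnorm : ‖WithLp.toLp 2 (Matrix.vecMul (α • x₁ + β • x₂) L)‖ ≤
      α * ‖WithLp.toLp 2 (Matrix.vecMul x₁ L)‖ + β * ‖WithLp.toLp 2 (Matrix.vecMul x₂ L)‖ := by
    rw [Matrix.add_vecMul, Matrix.smul_vecMul, Matrix.smul_vecMul, WithLp.toLp_add,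
      WithLp.toLp_smul, WithLp.toLp_smul]
    refine (norm_add_le _ _).trans_eq ?_
    rw [norm_smul, norm_smul, Real.norm_of_nonneg hα, Real.norm_of_nonneg hβ]
  refine (le_gaussianReal_abs_mul_add_le (by linarith) (by linarith) hα hβ (norm_nonneg _)
    (norm_nonneg _) (norm_nonneg _) hnorm h₁ h₂).trans (measureReal_mono fun g hg ↦ ?_)
  simp only [mem_ofPred_eq] at hg ⊢
  have hmean : (α • x₁ + β • x₂) ⬝ᵥ μ + (α * b₁ + β * b₂) =
      α * (x₁ ⬝ᵥ μ + b₁) + β * (x₂ ⬝ᵥ μ + b₂) := by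
    rw [add_dotProduct, smul_dotProduct, smul_dotProduct, smul_eq_mul, smul_eq_mul]
    ring
  rw [hmean]
  have convex_sq (p q : ℝ) : (α * p + β * q) ^ 2 ≤ α * p ^ 2 + β * q ^ 2 := by
    simpa using (even_two.convexOn_pow (𝕜 := ℝ)).2 (mem_univ p) (mem_univ q) hα hβ hαβ
  have hr := sq_le_sq' (abs_le.1 hg).1 (abs_le.1 hg).2
  have hr' := convex_sq √(k₁ - z₁ ^ 2) √(k₂ - z₂ ^ 2)
  rw [Real.sq_sqrt (sub_nonneg.2 hk₁), Real.sq_sqrt (sub_nonneg.2 hk₂)] at hr'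
  linarith [convex_sq z₁ z₂]
end

section
/- Let ε ∈ (0, 1/2], and let a < 0 and b > 0 be real constants. Then the function h : (0,1) → ℝ defined by h(λ) = a·q(λε) + b·q(1 − (1 − λ)ε) is strictly convex on (0, 1). (This is the restriction of the linear objective g(x,y) = ax + by to the boundary parameterization of S_ε.) -/
open MeasureTheory ProbabilityTheory Set

/-- The standard Gaussian CDF. -/
noncomputable def Phi (t : ℝ) : ℝ := ((gaussianReal 0 1) (Set.Iic t)).toReal

lemma Phi_eq_integral (t : ℝ) : Phi t = ∫ x in Iic t, gaussianPDFReal 0 1 x := by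
  rw [Phi, gaussianReal_apply_eq_integral _ one_ne_zero, ENNReal.toReal_ofReal]
  exact integral_nonneg fun x => gaussianPDFReal_nonneg _ _ x

lemma hasDerivAt_Phi (t : ℝ) : HasDerivAt Phi (gaussianPDFReal 0 1 t) t := by
  have hPhi : Phi = fun u => Phi 0 + ∫ x in (0 : ℝ)..u, gaussianPDFReal 0 1 x := by
    funext u
    have hint := integrable_gaussianPDFReal 0 1
    rw [← intervalIntegral.integral_Iic_sub_Iic hint.integrableOn hint.integrableOn,
      Phi_eq_integral, Phi_eq_integral]
    ring
  rw [hPhi]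
  exact (continuous_gaussianPDFReal_standard.integral_hasStrictDerivAt 0 t).hasDerivAt.const_add _

lemma deriv_Phi : deriv Phi = gaussianPDFReal 0 1 :=
  funext fun t => (hasDerivAt_Phi t).deriv

lemma continuous_Phi : Continuous Phi :=
  continuous_iff_continuousAt.2 fun t => (hasDerivAt_Phi t).continuousAt

lemma strictMono_Phi : StrictMono Phi :=
  strictMono_of_deriv_pos fun t => by
    rw [deriv_Phi]
    exact gaussianPDFReal_pos _ _ t one_ne_zero

lemma Phi_zero : Phi 0 = 1 / 2 := by
  have := nullSingletonClass_gaussianReal (μ := 0) (v := 1) one_ne_zero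
  have hneg : (gaussianReal 0 1) (Ioi 0) = (gaussianReal 0 1) (Iic 0) := by
    have hmap := gaussianReal_map_neg (μ := 0) (v := 1)
    rw [neg_zero] at hmap
    conv_lhs => rw [← hmap, Measure.map_apply measurable_neg measurableSet_Ioi]
    rw [← measure_congr (Iio_ae_eq_Iic (μ := gaussianReal 0 1) (a := (0 : ℝ)))]
    congr 1
    ext x
    simp
  have hadd := prob_add_prob_compl (μ := gaussianReal 0 1) (measurableSet_Iic (a := (0 : ℝ)))
  rw [compl_Iic, hneg] at hadd
  have htoReal := congrArg ENNReal.toReal hadd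
  rw [ENNReal.toReal_add (measure_ne_top _ _) (measure_ne_top _ _), ENNReal.toReal_one] at htoReal
  rw [Phi]
  linarith

lemma gaussianPDFReal_standard_lt {x y : ℝ} (h : y ^ 2 < x ^ 2) :
    gaussianPDFReal 0 1 x < gaussianPDFReal 0 1 y := by
  unfold gaussianPDFReal
  refine mul_lt_mul_of_pos_left (Real.exp_lt_exp.2 ?_) (by simp; positivity)
  simp only [sub_zero, NNReal.coe_one]
  linarith

lemma strictConvexOn_Phi : StrictConvexOn ℝ (Iic 0) Phi := by
  refine StrictMonoOn.strictConvexOn_of_deriv (convex_Iic 0) continuous_Phi.continuousOn ?_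
  rw [deriv_Phi, interior_Iic]
  intro x hx y hy hxy
  rw [mem_Iio] at hx hy
  exact gaussianPDFReal_standard_lt (by nlinarith)

lemma strictConcaveOn_Phi : StrictConcaveOn ℝ (Ici 0) Phi := by
  refine StrictAntiOn.strictConcaveOn_of_deriv (convex_Ici 0) continuous_Phi.continuousOn ?_
  rw [deriv_Phi, interior_Ici]
  intro x hx y hy hxy
  rw [mem_Ioi] at hx hy
  exact gaussianPDFReal_standard_lt (by nlinarith)

lemma strictConcaveOn_quantile {q : ℝ → ℝ} (hq : ∀ p ∈ Ioo (0 : ℝ) 1, Phi (q p) = p) :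
    StrictConcaveOn ℝ (Ioo 0 (1 / 2)) q := by
  have hq' : ∀ p ∈ Ioo (0 : ℝ) (1 / 2), Phi (q p) = p := fun p hp =>
    hq p ⟨hp.1, by linarith [hp.2]⟩
  have hmem : ∀ p ∈ Ioo (0 : ℝ) (1 / 2), q p ∈ Iic 0 := fun p hp =>
    strictMono_Phi.le_iff_le.1 (by rw [hq' p hp, Phi_zero]; exact hp.2.le)
  refine ⟨convex_Ioo _ _, fun x hx y hy hxy s t hs ht hst => strictMono_Phi.lt_iff_lt.1 ?_⟩
  have hne : q x ≠ q y := fun h => hxy (by rw [← hq' x hx, h, hq' y hy])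
  rw [hq' _ (convex_Ioo _ _ hx hy hs.le ht.le hst)]
  simpa only [hq' x hx, hq' y hy] using
    strictConvexOn_Phi.2 (hmem x hx) (hmem y hy) hne hs ht hst

lemma strictConvexOn_quantile {q : ℝ → ℝ} (hq : ∀ p ∈ Ioo (0 : ℝ) 1, Phi (q p) = p) :
    StrictConvexOn ℝ (Ioo (1 / 2) 1) q := by
  have hq' : ∀ p ∈ Ioo (1 / 2 : ℝ) 1, Phi (q p) = p := fun p hp =>
    hq p ⟨by linarith [hp.1], hp.2⟩
  have hmem : ∀ p ∈ Ioo (1 / 2 : ℝ) 1, q p ∈ Ici 0 := fun p hp =>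
    strictMono_Phi.le_iff_le.1 (by rw [hq' p hp, Phi_zero]; exact hp.1.le)
  refine ⟨convex_Ioo _ _, fun x hx y hy hxy s t hs ht hst => strictMono_Phi.lt_iff_lt.1 ?_⟩
  have hne : q x ≠ q y := fun h => hxy (by rw [← hq' x hx, h, hq' y hy])
  rw [hq' _ (convex_Ioo _ _ hx hy hs.le ht.le hst)]
  simpa only [hq' x hx, hq' y hy] using
    strictConcaveOn_Phi.2 (hmem x hx) (hmem y hy) hne hs ht hst

/-- The restriction of the linear objective `g(x,y) = ax + by` (with `a < 0 < b`) to the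
boundary parameterization of `S_ε` is strictly convex on `(0,1)`. Here `q` is the standard
Gaussian quantile function. -/
theorem stmt11 (ε : ℝ) (hε0 : 0 < ε) (hε : ε ≤ 1 / 2) (a b : ℝ) (ha : a < 0) (hb : 0 < b)
    (q : ℝ → ℝ) (hq : ∀ p ∈ Set.Ioo (0 : ℝ) 1, Phi (q p) = p) :
    StrictConvexOn ℝ (Set.Ioo (0 : ℝ) 1)
      (fun l : ℝ => a * q (l * ε) + b * q (1 - (1 - l) * ε)) := by
  refine ⟨convex_Ioo _ _, fun x hx y hy hxy s t hs ht hst => ?_⟩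
  have hlow : ∀ l ∈ Ioo (0 : ℝ) 1, l * ε ∈ Ioo (0 : ℝ) (1 / 2) := fun l hl =>
    ⟨mul_pos hl.1 hε0, by nlinarith [hl.2]⟩
  have hhigh : ∀ l ∈ Ioo (0 : ℝ) 1, 1 - (1 - l) * ε ∈ Ioo (1 / 2 : ℝ) 1 := fun l hl =>
    ⟨by nlinarith [hl.1], by nlinarith [mul_pos (sub_pos.2 hl.2) hε0]⟩
  have hconc := (strictConcaveOn_quantile hq).2 (hlow x hx) (hlow y hy)
    (fun h => hxy (mul_right_cancel₀ hε0.ne' h)) hs ht hst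
  have hconv := (strictConvexOn_quantile hq).2 (hhigh x hx) (hhigh y hy)
    (fun h => hxy (mul_right_cancel₀ hε0.ne' (by linarith))) hs ht hst
  have hlow_eq : s • (x * ε) + t • (y * ε) = (s • x + t • y) * ε := by
    simp only [smul_eq_mul]
    ring
  have hhigh_eq : s • (1 - (1 - x) * ε) + t • (1 - (1 - y) * ε) =
      1 - (1 - (s • x + t • y)) * ε := by
    simp only [smul_eq_mul]
    linear_combination (1 - ε) * hst
  rw [hlow_eq] at hconc
  rw [hhigh_eq] at hconv
  simp only [smul_eq_mul] at hconc hconv ⊢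
  linarith [mul_lt_mul_of_neg_left hconc ha, mul_lt_mul_of_pos_left hconv hb]
end

section
/- Let ε ∈ (0, 1/2]. For every (x, y) ∈ ℝ² satisfying x ≤ q(ε), y ≥ q(1 − ε), and x − y ≤ 2·q(ε/2), one has Φ(y) − Φ(x) ≥ 1 − 1.5ε. That is, the 'three-cut' family of polyhedral outer approximations B_ε = {(x,y) : x ≤ q(ε), y ≥ q(1−ε), x − y ≤ 2q(ε/2)} forms a 1.5-approximation of S_ε. -/
open MeasureTheory ProbabilityTheory Set

theorem Phi_monotone : Monotone Phi := fun _ _ h =>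
  measureReal_mono (μ := gaussianReal 0 1) (Iic_subset_Iic.mpr h)

theorem one_sub_Phi_le_Phi_neg (t : ℝ) : 1 - Phi t ≤ Phi (-t) := by
  have hmap : (gaussianReal 0 1).map (fun x : ℝ => -x) = gaussianReal 0 1 := by
    rw [gaussianReal_map_neg, neg_zero]
  have hneg : Phi (-t) = (gaussianReal 0 1).real (Ici t) := by
    rw [Phi, ← hmap, Measure.map_apply measurable_neg measurableSet_Iic]
    simp [Measure.real, hmap]
  have hcompl : 1 - Phi t = (gaussianReal 0 1).real (Ioi t) := by
    rw [← compl_Iic, probReal_compl_eq_one_sub measurableSet_Iic]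
    rfl
  rw [hneg, hcompl]
  exact measureReal_mono Ioi_subset_Ici_self

/-- The "three-cut" polyhedron `B_ε` forms a 1.5-approximation of `S_ε`: every point
satisfying `x ≤ q(ε)`, `y ≥ q(1−ε)` and `x − y ≤ 2q(ε/2)` has `Φ(y) − Φ(x) ≥ 1 − 1.5ε`.
Here `q` is the standard Gaussian quantile function. -/
theorem stmt16 (q : ℝ → ℝ) (hq : ∀ p ∈ Set.Ioo (0 : ℝ) 1, Phi (q p) = p)
    (ε : ℝ) (hε0 : 0 < ε) (hε : ε ≤ 1 / 2) :
    ∀ x y : ℝ, x ≤ q ε → q (1 - ε) ≤ y → x - y ≤ 2 * q (ε / 2) →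
      Phi y - Phi x ≥ 1 - 1.5 * ε := by
  intro x y hx hy hxy
  have hΦx : Phi x ≤ ε := (Phi_monotone hx).trans_eq (hq ε ⟨hε0, by linarith⟩)
  have hΦy : 1 - ε ≤ Phi y :=
    (hq (1 - ε) ⟨by linarith, by linarith⟩).symm.trans_le (Phi_monotone hy)
  have hΦq : Phi (q (ε / 2)) = ε / 2 := hq _ ⟨by linarith, by linarith⟩
  rcases le_total x (q (ε / 2)) with h | h
  · have := Phi_monotone h
    linarith
  · have hle : Phi (-q (ε / 2)) ≤ Phi y := Phi_monotone (by linarith)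
    have := one_sub_Phi_le_Phi_neg (q (ε / 2))
    linarith
end
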